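/- arXiv:2010.14975 — 2 statements merged into one kernel-verified Lean document; each statement's English description precedes it below -/
import Mathlib

section
/- Let m, n be natural numbers and let A = (a,b) and B = (a',b') be dominant B_{m|n}-data. Assume that A is stable, that A and B have equal core, and that B ≤ A. Then B is stable. (This is Corollary 5.4 of the paper for g = osp(2m+1|2n): a dominant weight ν with ν ≤ λ, core(ν) = core(λ) and λ stable is itself stable.) -/
/-!
Statement 0: For `g = osp(2m+1|2n)`: if `A = (a,b)` is a stable dominant
`B_{m|n}`-datum, `B = (a',b')` is a dominant `B_{m|n}`-datum with the same core
and `B ≤ A`, then `B` is stable.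
-/

namespace GorelikHeidersdorfB

open Finset

/-- The ambient weight space `ℚ^m × ℚ^n`. -/
abbrev V (m n : ℕ) := (Fin m → ℚ) × (Fin n → ℚ)

/-- The basis vector `ε_i` (1-indexed); `0` when `i` is out of range. -/
def eps (m n : ℕ) (i : ℕ) : V m n :=
  (fun j => if (j : ℕ) + 1 = i then 1 else 0, 0)

/-- The basis vector `δ_j` (1-indexed); `0` when `j` is out of range. -/
def delta (m n : ℕ) (j : ℕ) : V m n :=
  (0, fun k => if (k : ℕ) + 1 = j then 1 else 0)

/-- The sequence `u_1, …, u_{m+n}` for `osp(2m+1|2n)`: for `m ≥ n` it is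
`ε_1, …, ε_{m-n+1}, δ_1, ε_{m-n+2}, δ_2, …, ε_m, δ_n`, and for `n > m` it is
`δ_1, …, δ_{n-m}, ε_1, δ_{n-m+1}, ε_2, …, ε_m, δ_n`. -/
def uB (m n : ℕ) (t : ℕ) : V m n :=
  if n ≤ m then
    if t ≤ m - n + 1 then eps m n t
    else if (t - (m - n + 1)) % 2 = 1 then delta m n ((t - (m - n + 1) + 1) / 2)
    else eps m n (m - n + 1 + (t - (m - n + 1)) / 2)
  else
    if t ≤ n - m then delta m n t
    else if (t - (n - m)) % 2 = 1 then eps m n ((t - (n - m) + 1) / 2)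
    else delta m n (n - m + (t - (n - m)) / 2)

/-- The simple roots `Σ` of `osp(2m+1|2n)`, indexed by `1 ≤ t ≤ m+n`:
for `t ≤ m+n-1` the root `u_t - u_{t+1}`, and for `t = m+n` the root `δ_n`. -/
def rootB (m n : ℕ) (t : ℕ) : V m n :=
  if t ≤ m + n - 1 then uB m n t - uB m n (t + 1) else delta m n n

/-- `B ≤ A` : the difference `A - B` is a linear combination of elements of `Σ`
with non-negative integer coefficients. -/
def leB (m n : ℕ) (B A : V m n) : Prop :=
  ∃ c : ℕ → ℕ, A - B = ∑ t ∈ Finset.Icc 1 (m + n), (c t : ℚ) • rootB m n t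

/-- `(a, b)` is a `B_{m|n}`-datum: every `a i + 1/2` and every `b j - 1/2` is a
non-negative integer. -/
def IsBDatum {m n : ℕ} (a : Fin m → ℚ) (b : Fin n → ℚ) : Prop :=
  (∀ i, ∃ k : ℕ, a i + 1/2 = k) ∧ (∀ j, ∃ k : ℕ, b j - 1/2 = k)

/-- `mult_a(v) = #{i : |a_i| = v}`. -/
def multA {m : ℕ} (a : Fin m → ℚ) (v : ℚ) : ℕ :=
  (univ.filter fun i => |a i| = v).card

/-- `mult_b(v) = #{j : b_j = v}`. -/
def multB {n : ℕ} (b : Fin n → ℚ) (v : ℚ) : ℕ :=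
  (univ.filter fun j => b j = v).card

/-- Dominance for a `B_{m|n}`-datum. -/
def BDominant {m n : ℕ} (a : Fin m → ℚ) (b : Fin n → ℚ) : Prop :=
  (∀ i j : Fin m, i ≤ j → a j ≤ a i) ∧
  (∀ i j : Fin m, i < j → a i = a j → a i = -(1/2)) ∧
  (∀ i j : Fin n, i ≤ j → b j ≤ b i) ∧
  (∀ i j : Fin n, i < j → b i = b j → b i = 1/2) ∧
  (multA a (1/2) ≤ multB b (1/2) + 1 ∧ multB b (1/2) ≤ multA a (1/2) + 1)

/-- `v` is a `×`-value. -/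
def IsCrossValue {m n : ℕ} (a : Fin m → ℚ) (b : Fin n → ℚ) (v : ℚ) : Prop :=
  1 ≤ min (multA a v) (multB b v)

/-- `v` is a `>`-value. -/
def IsGtValue {m n : ℕ} (a : Fin m → ℚ) (b : Fin n → ℚ) (v : ℚ) : Prop :=
  multB b v < multA a v

/-- `v` is a `<`-value. -/
def IsLtValue {m n : ℕ} (a : Fin m → ℚ) (b : Fin n → ℚ) (v : ℚ) : Prop :=
  multA a v < multB b v

/-- `v` is a core value. -/
def IsCoreValue {m n : ℕ} (a : Fin m → ℚ) (b : Fin n → ℚ) (v : ℚ) : Prop :=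
  IsGtValue a b v ∨ IsLtValue a b v

/-- Two data have equal core: the same `>`-values and the same `<`-values. -/
def EqualCore {m n m' n' : ℕ} (a : Fin m → ℚ) (b : Fin n → ℚ)
    (a' : Fin m' → ℚ) (b' : Fin n' → ℚ) : Prop :=
  (∀ v, IsGtValue a b v ↔ IsGtValue a' b' v) ∧
  (∀ v, IsLtValue a b v ↔ IsLtValue a' b' v)

/-- Stability: every `×`-value is strictly smaller than every core value. -/
def BStable {m n : ℕ} (a : Fin m → ℚ) (b : Fin n → ℚ) : Prop :=
  ∀ v w, IsCrossValue a b v → IsCoreValue a b w → v < w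

lemma sum_fin_ite_val_succ_eq {m p : ℕ} (hp : p ≤ m) (i : ℕ) :
    (∑ j ∈ univ.filter (fun j : Fin m => (j : ℕ) < p), (if (j : ℕ) + 1 = i then (1 : ℚ) else 0)) =
      if 1 ≤ i ∧ i ≤ p then 1 else 0 := by
  split_ifs with h
  · rw [Finset.sum_eq_single_of_mem (⟨i - 1, by omega⟩ : Fin m)]
    · rw [if_pos (by simp only []; omega)]
    · simp only [mem_filter, mem_univ, true_and]; omega
    · intro j _ hj
      rw [if_neg]
      intro h'
      exact hj (Fin.ext (by simp only []; omega))
  · refine Finset.sum_eq_zero fun j hj => ?_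
    simp only [mem_filter, mem_univ, true_and] at hj
    rw [if_neg (by omega)]

/-- The sum of the first `p` coordinates along `ε` and the first `q` coordinates along `δ`. -/
def headSum (m n p q : ℕ) : V m n →ₗ[ℚ] ℚ where
  toFun X := (∑ i ∈ univ.filter (fun i : Fin m => (i : ℕ) < p), X.1 i) +
      ∑ j ∈ univ.filter (fun j : Fin n => (j : ℕ) < q), X.2 j
  map_add' X Y := by
    simp only [Prod.fst_add, Prod.snd_add, Pi.add_apply, Finset.sum_add_distrib]
    ring
  map_smul' c X := by
    simp only [Prod.smul_fst, Prod.smul_snd, Pi.smul_apply, smul_eq_mul, ← Finset.mul_sum,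
      RingHom.id_apply]
    ring

lemma headSum_apply (m n p q : ℕ) (X : V m n) :
    headSum m n p q X =
      (∑ i ∈ univ.filter (fun i : Fin m => (i : ℕ) < p), X.1 i) +
        ∑ j ∈ univ.filter (fun j : Fin n => (j : ℕ) < q), X.2 j := rfl

lemma headSum_eps {m p : ℕ} (n q : ℕ) (hp : p ≤ m) (i : ℕ) :
    headSum m n p q (eps m n i) = if 1 ≤ i ∧ i ≤ p then 1 else 0 := by
  simpa [headSum_apply, eps] using sum_fin_ite_val_succ_eq hp i

lemma headSum_delta {n q : ℕ} (m p : ℕ) (hq : q ≤ n) (j : ℕ) :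
    headSum m n p q (delta m n j) = if 1 ≤ j ∧ j ≤ q then 1 else 0 := by
  simpa [headSum_apply, delta] using sum_fin_ite_val_succ_eq hq j

lemma headSum_uB {m n p q : ℕ} (hp : p ≤ m) (hq : q ≤ n) (hpq : p + n = q + m) {t : ℕ}
    (ht : 1 ≤ t) :
    headSum m n p q (uB m n t) = if t ≤ p + q then 1 else 0 := by
  unfold uB
  split_ifs <;> simp only [headSum_eps n q hp, headSum_delta m p hq, ite_eq_left_iff,
    ite_eq_right_iff, zero_ne_one, one_ne_zero] <;> omega

lemma headSum_rootB_nonneg {m n p q : ℕ} (hp : p ≤ m) (hq : q ≤ n) (hpq : p + n = q + m) {t : ℕ}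
    (ht : 1 ≤ t) : 0 ≤ headSum m n p q (rootB m n t) := by
  unfold rootB
  split_ifs
  · rw [map_sub, headSum_uB hp hq hpq ht, headSum_uB hp hq hpq (by omega)]
    split_ifs <;> first | omega | norm_num
  · rw [headSum_delta m p hq]
    split_ifs <;> norm_num

lemma leB.headSum_le {m n p q : ℕ} {A B : V m n} (h : leB m n B A) (hp : p ≤ m) (hq : q ≤ n)
    (hpq : p + n = q + m) : headSum m n p q B ≤ headSum m n p q A := by
  obtain ⟨c, hc⟩ := h
  rw [← sub_nonneg, ← map_sub, hc, map_sum]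
  refine Finset.sum_nonneg fun t ht => ?_
  rw [map_smul, smul_eq_mul]
  exact mul_nonneg (Nat.cast_nonneg _) (headSum_rootB_nonneg hp hq hpq (Finset.mem_Icc.1 ht).1)

/-- If the first `p` terms of `x` are distinct and all occur among the terms of the decreasing
sequence `y`, then `x` is dominated termwise by `y` on its first `p` terms. -/
lemma le_of_antitone_of_mem {m p : ℕ} {x y : Fin m → ℚ} (hx : Antitone x) (hy : Antitone y)
    (hinj : ∀ i j : Fin m, (i : ℕ) < p → (j : ℕ) < p → x i = x j → i = j)
    (hmem : ∀ i : Fin m, (i : ℕ) < p → ∃ j, y j = x i) {i : Fin m} (hi : (i : ℕ) < p) :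
    x i ≤ y i := by
  by_contra! hlt
  have hmem' : ∀ j : Fin m, ∃ l, (j : ℕ) < p → y l = x j := fun j => by
    by_cases hj : (j : ℕ) < p
    · obtain ⟨l, hl⟩ := hmem j hj
      exact ⟨l, fun _ => hl⟩
    · exact ⟨j, fun h => absurd h hj⟩
  choose f hf using hmem'
  have hcard : (Finset.Iic i).card ≤ (Finset.Iio i).card := by
    refine Finset.card_le_card_of_injOn f (fun j hj => ?_) (fun j hj l hl hjl => ?_)
    · have hj' : j ≤ i := by simpa using hj
      have h1 := hf j (lt_of_le_of_lt (Fin.le_def.1 hj') hi)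
      have h2 := hx hj'
      simp only [Finset.coe_Iio, Set.mem_Iio]
      by_contra! h3
      have := hy h3
      linarith
    · have hj' : j ≤ i := by simpa using hj
      have hl' : l ≤ i := by simpa using hl
      have hjp := lt_of_le_of_lt (Fin.le_def.1 hj') hi
      have hlp := lt_of_le_of_lt (Fin.le_def.1 hl') hi
      refine hinj j l hjp hlp ?_
      rw [← hf j hjp, ← hf l hlp, hjl]
  simp at hcard

lemma sum_lt_sum_of_antitone_of_mem {m p : ℕ} {x y : Fin m → ℚ} (hx : Antitone x)
    (hy : Antitone y)
    (hinj : ∀ i j : Fin m, (i : ℕ) < p → (j : ℕ) < p → x i = x j → i = j)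
    (hmem : ∀ i : Fin m, (i : ℕ) < p → ∃ j, y j = x i) {i j : Fin m} (hi : (i : ℕ) < p)
    (hij : x i < y j) (hj : ∀ l : Fin m, (l : ℕ) < p → x l ≠ y j) :
    ∑ l ∈ univ.filter (fun l : Fin m => (l : ℕ) < p), x l <
      ∑ l ∈ univ.filter (fun l : Fin m => (l : ℕ) < p), y l := by
  have hle : ∀ l : Fin m, (l : ℕ) < p → x l ≤ y l := fun l hl =>
    le_of_antitone_of_mem hx hy hinj hmem hl
  refine Finset.sum_lt_sum (fun l hl => hle l (by simpa using hl)) ?_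
  by_contra! h
  have heq : ∀ l : Fin m, (l : ℕ) < p → x l = y l := fun l hl =>
    le_antisymm (hle l hl) (h l (by simpa using hl))
  have hji : j < i := by
    by_contra! hji
    have := hy hji
    rw [← heq i hi] at this
    linarith
  have hjp : (j : ℕ) < p := lt_trans (Fin.lt_def.1 hji) hi
  exact hj j hjp (heq j hjp)

/-- A downward closed condition on `Fin m` cuts out an initial segment. -/
lemma val_lt_card_filter_iff {m : ℕ} (P : Fin m → Prop) [DecidablePred P]
    (hP : ∀ i j : Fin m, i ≤ j → P j → P i) :
    ∀ i : Fin m, (i : ℕ) < (univ.filter P).card ↔ P i := by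
  intro i
  constructor
  · intro h
    by_contra hi
    have : (univ.filter P).card ≤ (Finset.Iio i).card := by
      refine Finset.card_le_card fun j hj => ?_
      rw [Finset.mem_Iio]
      by_contra! hij
      exact hi (hP i j hij (Finset.mem_filter.1 hj).2)
    simp at this
    omega
  · intro h
    have : (Finset.Iic i).card ≤ (univ.filter P).card := by
      refine Finset.card_le_card fun j hj => ?_
      simp only [mem_filter, mem_univ, true_and]
      exact hP j i (Finset.mem_Iic.1 hj) h
    simp at this
    omega

section Multiplicities

variable {m n : ℕ} {a a' : Fin m → ℚ} {b b' : Fin n → ℚ} {v w : ℚ}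

lemma multA_pos_iff : 1 ≤ multA a v ↔ ∃ i, |a i| = v := by
  simp [multA, Nat.one_le_iff_ne_zero, Finset.filter_eq_empty_iff]

lemma multB_pos_iff : 1 ≤ multB b v ↔ ∃ j, b j = v := by
  simp [multB, Nat.one_le_iff_ne_zero, Finset.filter_eq_empty_iff]

lemma isCrossValue_iff : IsCrossValue a b v ↔ 1 ≤ multA a v ∧ 1 ≤ multB b v := le_min_iff

lemma IsBDatum.neg_half_le (h : IsBDatum a b) (i : Fin m) : -(1 / 2) ≤ a i := by
  obtain ⟨k, hk⟩ := h.1 i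
  have : (0 : ℚ) ≤ k := Nat.cast_nonneg k
  linarith

lemma IsBDatum.half_le (h : IsBDatum a b) (j : Fin n) : 1 / 2 ≤ b j := by
  obtain ⟨k, hk⟩ := h.2 j
  have : (0 : ℚ) ≤ k := Nat.cast_nonneg k
  linarith

lemma IsBDatum.abs_eq_iff (h : IsBDatum a b) (hv : 1 / 2 < v) (i : Fin m) :
    |a i| = v ↔ a i = v := by
  have := h.neg_half_le i
  constructor
  · intro hi
    rcases abs_choice (a i) with h' | h' <;> linarith
  · rintro rfl
    exact abs_of_nonneg (by linarith)

lemma BDominant.multA_le_one (hd : IsBDatum a b) (h : BDominant a b) (hv : 1 / 2 < v) :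
    multA a v ≤ 1 := by
  refine Finset.card_le_one.2 fun i hi j hj => ?_
  simp only [mem_filter, mem_univ, true_and, hd.abs_eq_iff hv] at hi hj
  by_contra hne
  rcases lt_or_gt_of_ne hne with hij | hij
  · have := h.2.1 i j hij (by rw [hi, hj])
    linarith
  · have := h.2.1 j i hij (by rw [hi, hj])
    linarith

lemma BDominant.multB_le_one (h : BDominant a b) (hv : v ≠ 1 / 2) : multB b v ≤ 1 := by
  refine Finset.card_le_one.2 fun i hi j hj => ?_
  simp only [mem_filter, mem_univ, true_and] at hi hj
  by_contra hne
  rcases lt_or_gt_of_ne hne with hij | hij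
  · exact hv (hi ▸ h.2.2.2.1 i j hij (by rw [hi, hj]))
  · exact hv (hj ▸ h.2.2.2.1 j i hij (by rw [hi, hj]))

lemma IsBDatum.half_le_of_abs (hd : IsBDatum a b) (i : Fin m) : 1 / 2 ≤ |a i| := by
  obtain ⟨k, hk⟩ := hd.1 i
  rcases Nat.eq_zero_or_pos k with rfl | hk0
  · rw [show a i = -(1 / 2) by push_cast at hk; linarith]
    norm_num
  · have : (1 : ℚ) ≤ k := by exact_mod_cast hk0
    exact le_trans (by linarith) (le_abs_self _)

lemma BDominant.mult_le_succ (hd : IsBDatum a b) (h : BDominant a b) (v : ℚ) :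
    multA a v ≤ multB b v + 1 ∧ multB b v ≤ multA a v + 1 := by
  rcases lt_trichotomy v (1 / 2) with hv | rfl | hv
  · have h1 : multA a v = 0 := by
      by_contra h0
      obtain ⟨i, rfl⟩ := multA_pos_iff.1 (Nat.one_le_iff_ne_zero.2 h0)
      linarith [hd.half_le_of_abs i]
    have := h.multB_le_one hv.ne
    omega
  · exact h.2.2.2.2
  · have := h.multA_le_one hd hv
    have := h.multB_le_one hv.ne'
    omega

lemma EqualCore.mult_add_eq (hA : IsBDatum a b) (hB : IsBDatum a' b') (hAd : BDominant a b)
    (hBd : BDominant a' b') (hcore : EqualCore a b a' b') (v : ℚ) :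
    multA a v + multB b' v = multA a' v + multB b v := by
  have h1 := hcore.1 v
  have h2 := hcore.2 v
  have h3 := hAd.mult_le_succ hA v
  have h4 := hBd.mult_le_succ hB v
  unfold IsGtValue at h1
  unfold IsLtValue at h2
  omega

lemma sum_multA {S : Finset ℚ} (hS : ∀ i, |a i| ∈ S) : ∑ v ∈ S, multA a v = m := by
  have := Finset.card_eq_sum_card_fiberwise (s := univ) (f := fun i => |a i|) (t := S)
    (fun i _ => hS i)
  simpa [multA] using this.symm

/-- Typicality depends only on the core. -/
lemma EqualCore.not_isCrossValue (hA : IsBDatum a b) (hB : IsBDatum a' b') (hAd : BDominant a b)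
    (hBd : BDominant a' b') (hcore : EqualCore a b a' b') (h : ∀ v, ¬ IsCrossValue a b v) (v : ℚ) :
    ¬ IsCrossValue a' b' v := by
  intro hv
  set S : Finset ℚ := univ.image (fun i => |a i|) ∪ univ.image (fun i => |a' i|) with hS
  have hle : ∀ w, multA a w ≤ multA a' w ∧ (IsCrossValue a' b' w → multA a w < multA a' w) := by
    intro w
    have h1 := hcore.mult_add_eq hA hB hAd hBd w
    have h2 := h w
    rw [isCrossValue_iff] at h2
    rw [isCrossValue_iff]
    omega
  have hvS : v ∈ S := by
    obtain ⟨i, rfl⟩ := multA_pos_iff.1 (isCrossValue_iff.1 hv).1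
    simp [hS]
  have hlt : ∑ w ∈ S, multA a w < ∑ w ∈ S, multA a' w :=
    Finset.sum_lt_sum (fun w _ => (hle w).1) ⟨v, hvS, (hle v).2 hv⟩
  rw [sum_multA (fun i => by simp [hS]), sum_multA (fun i => by simp [hS])] at hlt
  exact lt_irrefl _ hlt

open Classical in
/-- The numbers of entries of `a` and of `b` that are not core values agree. -/
lemma card_not_isCoreValue :
    (univ.filter fun i => ¬ IsCoreValue a b |a i|).card =
      (univ.filter fun j => ¬ IsCoreValue a b (b j)).card := by
  set S : Finset ℚ := univ.image (fun i => |a i|) ∪ univ.image b with hS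
  rw [Finset.card_eq_sum_card_fiberwise (f := fun i => |a i|) (t := S)
      (fun i _ => by simp [hS]),
    Finset.card_eq_sum_card_fiberwise (f := b) (t := S) (fun i _ => by simp [hS])]
  refine Finset.sum_congr rfl fun v _ => ?_
  by_cases hv : IsCoreValue a b v
  · rw [Finset.card_eq_zero.2, Finset.card_eq_zero.2] <;>
    · rw [Finset.filter_eq_empty_iff]
      rintro i hi rfl
      exact (Finset.mem_filter.1 hi).2 hv
  · have hA : (univ.filter fun i => ¬ IsCoreValue a b |a i|).filter (fun i => |a i| = v) =
        univ.filter fun i => |a i| = v := by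
      ext i
      simp only [mem_filter, mem_univ, true_and, and_iff_right_iff_imp]
      rintro rfl
      exact hv
    have hB : (univ.filter fun j => ¬ IsCoreValue a b (b j)).filter (fun j => b j = v) =
        univ.filter fun j => b j = v := by
      ext j
      simp only [mem_filter, mem_univ, true_and, and_iff_right_iff_imp]
      rintro rfl
      exact hv
    rw [hA, hB]
    simp only [IsCoreValue, IsGtValue, IsLtValue, not_or, not_lt] at hv
    exact le_antisymm hv.1 hv.2

open Classical in
lemma card_isCoreValue :
    (univ.filter fun i => IsCoreValue a b |a i|).card + n =
      (univ.filter fun j => IsCoreValue a b (b j)).card + m := by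
  have h1 := Finset.card_filter_add_card_filter_not (s := (univ : Finset (Fin m)))
    (fun i => IsCoreValue a b |a i|)
  have h2 := Finset.card_filter_add_card_filter_not (s := (univ : Finset (Fin n)))
    (fun j => IsCoreValue a b (b j))
  have h3 := card_not_isCoreValue (a := a) (b := b)
  simp only [Finset.card_univ, Fintype.card_fin] at h1 h2
  omega

lemma BStable.not_isCrossValue (h : BStable a b) (hv : IsCoreValue a b v) :
    ¬ IsCrossValue a b v := fun hc => lt_irrefl v (h v v hc hv)

/-- In a stable datum the entries larger than a core value are core values. -/
lemma BStable.isCoreValue_of_le (h : BStable a b) (hw : IsCoreValue a b w) (hwv : w ≤ v)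
    (hv : 1 ≤ multA a v ∨ 1 ≤ multB b v) : IsCoreValue a b v := by
  by_contra hc
  have hc' := hc
  simp only [IsCoreValue, IsGtValue, IsLtValue, not_or, not_lt] at hc'
  exact absurd (h v w (isCrossValue_iff.2 (by omega)) hw) (not_lt.2 hwv)

end Multiplicities

/-- **Corollary 5.4** for `osp(2m+1|2n)`: a dominant datum `B ≤ A` with the same
core as a stable dominant datum `A` is itself stable. -/
theorem BStable_of_le_of_equalCore (m n : ℕ)
    (a a' : Fin m → ℚ) (b b' : Fin n → ℚ)
    (hAdatum : IsBDatum a b) (hBdatum : IsBDatum a' b')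
    (hAdom : BDominant a b) (hBdom : BDominant a' b')
    (hAstable : BStable a b)
    (hcore : EqualCore a b a' b')
    (hle : leB m n (a', b') (a, b)) :
    BStable a' b' := by
  classical
  by_cases htyp : ∀ v, ¬ IsCrossValue a b v
  · intro v w hv
    exact absurd hv (hcore.not_isCrossValue hAdatum hBdatum hAdom hBdom htyp v)
  push Not at htyp
  obtain ⟨c, hc⟩ := htyp
  have hhalf : ∀ w, IsCoreValue a b w → 1 / 2 < w := fun w hw => by
    obtain ⟨j, rfl⟩ := multB_pos_iff.1 (isCrossValue_iff.1 hc).2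
    exact lt_of_le_of_lt (hAdatum.half_le j) (hAstable _ w hc hw)
  have hcoreA : ∀ i, IsCoreValue a b |a i| → |a i| = a i ∧ ∃ j, a' j = a i := by
    intro i hi
    have h1 := (hAdatum.abs_eq_iff (hhalf _ hi) i).1 rfl
    refine ⟨h1.symm, ?_⟩
    have h2 : 1 ≤ multA a |a i| := multA_pos_iff.2 ⟨i, rfl⟩
    have h3 := hcore.mult_add_eq hAdatum hBdatum hAdom hBdom |a i|
    have h4 := hAstable.not_isCrossValue hi
    rw [isCrossValue_iff] at h4
    obtain ⟨j, hj⟩ := multA_pos_iff.1 (show 1 ≤ multA a' |a i| by omega)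
    exact ⟨j, ((hBdatum.abs_eq_iff (hhalf _ hi) j).1 hj).trans h1.symm⟩
  have hcoreB : ∀ j, IsCoreValue a b (b j) → ∃ l, b' l = b j := by
    intro j hj
    have h2 : 1 ≤ multB b (b j) := multB_pos_iff.2 ⟨j, rfl⟩
    have h3 := hcore.mult_add_eq hAdatum hBdatum hAdom hBdom (b j)
    have h4 := hAstable.not_isCrossValue hj
    rw [isCrossValue_iff] at h4
    exact multB_pos_iff.1 (by omega)
  have hpi := val_lt_card_filter_iff (fun i => IsCoreValue a b |a i|) fun i j hij hj =>
    hAstable.isCoreValue_of_le hj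
      ((hcoreA j hj).1.trans_le ((hAdom.1 i j hij).trans (le_abs_self _)))
      (Or.inl (multA_pos_iff.2 ⟨i, rfl⟩))
  have hqj := val_lt_card_filter_iff (fun j => IsCoreValue a b (b j)) fun i j hij hj =>
    hAstable.isCoreValue_of_le hj (hAdom.2.2.1 i j hij) (Or.inr (multB_pos_iff.2 ⟨i, rfl⟩))
  have hpq := card_isCoreValue (a := a) (b := b)
  have hp : (univ.filter fun i => IsCoreValue a b |a i|).card ≤ m :=
    (Finset.card_le_univ _).trans_eq (Fintype.card_fin m)
  have hq : (univ.filter fun j => IsCoreValue a b (b j)).card ≤ n :=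
    (Finset.card_le_univ _).trans_eq (Fintype.card_fin n)
  generalize (univ.filter fun i => IsCoreValue a b |a i|).card = p at *
  generalize (univ.filter fun j => IsCoreValue a b (b j)).card = q at *
  have hsum := hle.headSum_le hp hq hpq
  simp only [headSum_apply] at hsum
  have hinjA : ∀ i j : Fin m, (i : ℕ) < p → (j : ℕ) < p → a i = a j → i = j := by
    intro i j hi _ hij
    exact Finset.card_le_one.1 (hAdom.multA_le_one hAdatum (hhalf _ ((hpi i).1 hi))) i (by simp)
      j (by simp [hij])
  have hinjB : ∀ i j : Fin n, (i : ℕ) < q → (j : ℕ) < q → b i = b j → i = j := by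
    intro i j hi _ hij
    exact Finset.card_le_one.1 (hAdom.multB_le_one (hhalf _ ((hqj i).1 hi)).ne') i (by simp)
      j (by simp [hij])
  have hmemA : ∀ i : Fin m, (i : ℕ) < p → ∃ j, a' j = a i := fun i hi =>
    (hcoreA i ((hpi i).1 hi)).2
  have hmemB : ∀ j : Fin n, (j : ℕ) < q → ∃ l, b' l = b j := fun j hj =>
    hcoreB j ((hqj j).1 hj)
  have hanti : Antitone a ∧ Antitone a' ∧ Antitone b ∧ Antitone b' :=
    ⟨fun i j h => hAdom.1 i j h, fun i j h => hBdom.1 i j h, fun i j h => hAdom.2.2.1 i j h,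
      fun i j h => hBdom.2.2.1 i j h⟩
  obtain ⟨ha, ha', hb, hb'⟩ := hanti
  have hleA : ∑ l ∈ univ.filter (fun l : Fin m => (l : ℕ) < p), a l ≤
      ∑ l ∈ univ.filter (fun l : Fin m => (l : ℕ) < p), a' l :=
    Finset.sum_le_sum fun l hl => le_of_antitone_of_mem ha ha' hinjA hmemA (by simpa using hl)
  have hleB : ∑ l ∈ univ.filter (fun l : Fin n => (l : ℕ) < q), b l ≤
      ∑ l ∈ univ.filter (fun l : Fin n => (l : ℕ) < q), b' l :=
    Finset.sum_le_sum fun l hl => le_of_antitone_of_mem hb hb' hinjB hmemB (by simpa using hl)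
  intro v w hv hw
  by_contra! hwv
  have hwA : IsCoreValue a b w := hw.imp (hcore.1 w).2 (hcore.2 w).2
  have hw2 := hhalf w hwA
  have hv2 : 1 / 2 < v := hw2.trans_le hwv
  have hvcross := isCrossValue_iff.1 hv
  have hvA : ¬ IsCoreValue a b v := by
    have h1 := hBdom.multA_le_one hBdatum hv2
    have h2 := hBdom.multB_le_one hv2.ne'
    have h3 := hcore.mult_add_eq hAdatum hBdatum hAdom hBdom v
    simp only [IsCoreValue, IsGtValue, IsLtValue]
    omega
  have hlt : w < v := lt_of_le_of_ne hwv fun h => hvA (h ▸ hwA)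
  rcases id hwA with hgt | hlt'
  · obtain ⟨i, rfl⟩ := multA_pos_iff.1 (show 1 ≤ multA a w from Nat.one_le_of_lt hgt)
    obtain ⟨j, hj⟩ := multA_pos_iff.1 hvcross.1
    obtain rfl := (hBdatum.abs_eq_iff hv2 j).1 hj
    have := sum_lt_sum_of_antitone_of_mem ha ha' hinjA hmemA ((hpi i).2 hwA)
      (lt_of_le_of_lt (le_abs_self _) hlt) (j := j) fun l hl hlj => by
        have h := (hpi l).1 hl
        rw [(hcoreA l h).1, hlj] at h
        exact hvA h
    linarith
  · obtain ⟨i, rfl⟩ := multB_pos_iff.1 (show 1 ≤ multB b w from Nat.one_le_of_lt hlt')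
    obtain ⟨j, rfl⟩ := multB_pos_iff.1 hvcross.2
    have := sum_lt_sum_of_antitone_of_mem hb hb' hinjB hmemB ((hqj i).2 hwA) hlt fun l hl hlj =>
      hvA (hlj ▸ (hqj l).1 hl)
    linarith

end GorelikHeidersdorfB
end

section
/- Let m ≥ 1 and n be natural numbers and let A = (a,b) and B = (a',b') be dominant D_{m|n}-data. Assume that A is stable, that A and B have equal core, and that B ≤ A. Then B is stable. (This is Corollary 5.4 of the paper for g = osp(2m|2n).) -/
/-!
Statement 1: For `g = osp(2m|2n)` (`m ≥ 1`): if `A = (a,b)` is a stable dominant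
`D_{m|n}`-datum, `B = (a',b')` is a dominant `D_{m|n}`-datum with the same core
and `B ≤ A`, then `B` is stable.
-/

namespace GorelikHeidersdorfD

open Finset

/-- The ambient weight space `ℚ^m × ℚ^n`. -/
abbrev V (m n : ℕ) := (Fin m → ℚ) × (Fin n → ℚ)

/-- The basis vector `ε_i` (1-indexed); `0` when `i` is out of range. -/
def eps (m n : ℕ) (i : ℕ) : V m n :=
  (fun j => if (j : ℕ) + 1 = i then 1 else 0, 0)

/-- The basis vector `δ_j` (1-indexed); `0` when `j` is out of range. -/
def delta (m n : ℕ) (j : ℕ) : V m n :=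
  (0, fun k => if (k : ℕ) + 1 = j then 1 else 0)

/-- The sequence `u_1, …, u_{m+n-1}` for `osp(2m|2n)`: for `n ≥ m` it is
`δ_1, …, δ_{n-m+1}, ε_1, δ_{n-m+2}, ε_2, …, ε_{m-1}, δ_n`, and for `m > n` it is
`ε_1, …, ε_{m-n}, δ_1, ε_{m-n+1}, δ_2, …, ε_{m-1}, δ_n`. -/
def uD (m n : ℕ) (t : ℕ) : V m n :=
  if m ≤ n then
    if t ≤ n - m + 1 then delta m n t
    else if (t - (n - m + 1)) % 2 = 1 then eps m n ((t - (n - m + 1) + 1) / 2)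
    else delta m n (n - m + 1 + (t - (n - m + 1)) / 2)
  else
    if t ≤ m - n then eps m n t
    else if (t - (m - n)) % 2 = 1 then delta m n ((t - (m - n) + 1) / 2)
    else eps m n (m - n + (t - (m - n)) / 2)

/-- The simple roots `Σ` of `osp(2m|2n)`, indexed by `1 ≤ t ≤ m+n`:
for `t ≤ m+n-2` the root `u_t - u_{t+1}`, for `t = m+n-1` the root `δ_n - ε_m`,
and for `t = m+n` the root `δ_n + ε_m`. -/
def rootD (m n : ℕ) (t : ℕ) : V m n :=
  if t ≤ m + n - 2 then uD m n t - uD m n (t + 1)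
  else if t = m + n - 1 then delta m n n - eps m n m
  else delta m n n + eps m n m

/-- `B ≤ A` : the difference `A - B` is a linear combination of elements of `Σ`
with non-negative integer coefficients. -/
def leD (m n : ℕ) (B A : V m n) : Prop :=
  ∃ c : ℕ → ℕ, A - B = ∑ t ∈ Finset.Icc 1 (m + n), (c t : ℚ) • rootD m n t

/-- `(a, b)` is a `D_{m|n}`-datum: all entries are integers. -/
def IsDDatum {m n : ℕ} (a : Fin m → ℚ) (b : Fin n → ℚ) : Prop :=
  (∀ i, ∃ k : ℤ, a i = k) ∧ (∀ j, ∃ k : ℤ, b j = k)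

/-- `mult_a(v) = #{i : |a_i| = v}`. -/
def multA {m : ℕ} (a : Fin m → ℚ) (v : ℚ) : ℕ :=
  (univ.filter fun i => |a i| = v).card

/-- `mult_b(v) = #{j : b_j = v}`. -/
def multB {n : ℕ} (b : Fin n → ℚ) (v : ℚ) : ℕ :=
  (univ.filter fun j => b j = v).card

/-- The chain `a_1, …, a_{m-1}, |a_m|`. -/
def achain {m : ℕ} (a : Fin m → ℚ) (i : Fin m) : ℚ :=
  if (i : ℕ) + 1 = m then |a i| else a i

/-- Dominance for a `D_{m|n}`-datum: `a_i ≥ 0` for `i < m`,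
`a_1 ≥ … ≥ a_{m-1} ≥ |a_m|` with equalities forcing the common value `0`,
`b_1 ≥ … ≥ b_n ≥ 0` with equalities forcing `0`, and
`#{j : b_j = 0} ≤ #{i : |a_i| = 0} ≤ #{j : b_j = 0} + 1`. -/
def DDominant {m n : ℕ} (a : Fin m → ℚ) (b : Fin n → ℚ) : Prop :=
  (∀ i : Fin m, (i : ℕ) + 1 < m → 0 ≤ a i) ∧
  (∀ i j : Fin m, i ≤ j → achain a j ≤ achain a i) ∧
  (∀ i j : Fin m, i < j → achain a i = achain a j → achain a i = 0) ∧
  (∀ j : Fin n, 0 ≤ b j) ∧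
  (∀ i j : Fin n, i ≤ j → b j ≤ b i) ∧
  (∀ i j : Fin n, i < j → b i = b j → b i = 0) ∧
  (multB b 0 ≤ multA a 0 ∧ multA a 0 ≤ multB b 0 + 1)

/-- `v` is a `×`-value. -/
def IsCrossValue {m n : ℕ} (a : Fin m → ℚ) (b : Fin n → ℚ) (v : ℚ) : Prop :=
  1 ≤ min (multA a v) (multB b v)

/-- `v` is a `>`-value. -/
def IsGtValue {m n : ℕ} (a : Fin m → ℚ) (b : Fin n → ℚ) (v : ℚ) : Prop :=
  multB b v < multA a v

/-- `v` is a `<`-value. -/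
def IsLtValue {m n : ℕ} (a : Fin m → ℚ) (b : Fin n → ℚ) (v : ℚ) : Prop :=
  multA a v < multB b v

/-- `v` is a core value. -/
def IsCoreValue {m n : ℕ} (a : Fin m → ℚ) (b : Fin n → ℚ) (v : ℚ) : Prop :=
  IsGtValue a b v ∨ IsLtValue a b v

/-- Two data have equal core: the same `>`-values and the same `<`-values. -/
def EqualCore {m n m' n' : ℕ} (a : Fin m → ℚ) (b : Fin n → ℚ)
    (a' : Fin m' → ℚ) (b' : Fin n' → ℚ) : Prop :=
  (∀ v, IsGtValue a b v ↔ IsGtValue a' b' v) ∧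
  (∀ v, IsLtValue a b v ↔ IsLtValue a' b' v)

/-- Stability (D case): every `×`-value is strictly smaller than every nonzero
core value. -/
def DStable {m n : ℕ} (a : Fin m → ℚ) (b : Fin n → ℚ) : Prop :=
  ∀ v w, IsCrossValue a b v → IsCoreValue a b w → w ≠ 0 → v < w

/-- A decreasing nonnegative sequence whose nonzero entries are pairwise distinct. -/
structure IsChain {m : ℕ} (g : Fin m → ℚ) : Prop where
  nonneg : ∀ i, 0 ≤ g i
  anti : ∀ i j, i ≤ j → g j ≤ g i
  eq_zero : ∀ i j, i < j → g i = g j → g i = 0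

/-- The indices of the nonzero entries of `g` that do not occur in `h`. -/
def unmatched {m n : ℕ} (g : Fin m → ℚ) (h : Fin n → ℚ) : Finset (Fin m) :=
  univ.filter fun i => g i ≠ 0 ∧ ∀ j, h j ≠ g i

/-- The first `p` indices. -/
def initial (m p : ℕ) : Finset (Fin m) := univ.filter fun i => (i : ℕ) < p

lemma mem_initial {m p : ℕ} {i : Fin m} : i ∈ initial m p ↔ (i : ℕ) < p := by
  simp [initial]

lemma mem_unmatched {m n : ℕ} {g : Fin m → ℚ} {h : Fin n → ℚ} {i : Fin m} :
    i ∈ unmatched g h ↔ g i ≠ 0 ∧ ∀ j, h j ≠ g i := by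
  simp [unmatched]

lemma one_le_multB {m : ℕ} {g : Fin m → ℚ} {v : ℚ} : 1 ≤ multB g v ↔ ∃ i, g i = v := by
  simp [multB, Nat.one_le_iff_ne_zero, Finset.filter_eq_empty_iff]

lemma multB_eq_zero {m : ℕ} {g : Fin m → ℚ} {v : ℚ} : multB g v = 0 ↔ ∀ i, g i ≠ v := by
  simp [multB, Finset.filter_eq_empty_iff]

lemma IsChain.injOn {m : ℕ} {g : Fin m → ℚ} (hg : IsChain g) :
    Set.InjOn g {i | g i ≠ 0} := by
  intro i hi j hj h
  rcases lt_trichotomy i j with h1 | h1 | h1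
  · exact absurd (hg.eq_zero i j h1 h) hi
  · exact h1
  · exact absurd (hg.eq_zero j i h1 h.symm) hj

lemma IsChain.multB_le_one {m : ℕ} {g : Fin m → ℚ} (hg : IsChain g) {v : ℚ} (hv : v ≠ 0) :
    multB g v ≤ 1 := by
  refine Finset.card_le_one.2 fun i hi j hj => ?_
  simp only [mem_filter, mem_univ, true_and] at hi hj
  exact hg.injOn (by simpa [hi] using hv) (by simpa [hj] using hv) (hi.trans hj.symm)

lemma IsChain.multB_lt_iff {m n : ℕ} {g : Fin m → ℚ} (hg : IsChain g) (h : Fin n → ℚ)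
    {v : ℚ} (hv : v ≠ 0) : multB h v < multB g v ↔ ∃ i ∈ unmatched g h, g i = v := by
  have h1 := hg.multB_le_one hv
  constructor
  · intro hlt
    obtain ⟨i, rfl⟩ := one_le_multB.1 (show 1 ≤ multB g v by omega)
    exact ⟨i, mem_unmatched.2 ⟨hv, multB_eq_zero.1 (by omega)⟩, rfl⟩
  · rintro ⟨i, hi, rfl⟩
    rw [multB_eq_zero.2 (mem_unmatched.1 hi).2]
    exact one_le_multB.2 ⟨i, rfl⟩

lemma IsChain.injOn_unmatched {m n : ℕ} {g : Fin m → ℚ} (hg : IsChain g) (h : Fin n → ℚ) :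
    Set.InjOn g (unmatched g h) :=
  hg.injOn.mono fun _ hi => (mem_unmatched.1 hi).1

lemma image_unmatched_eq {m n : ℕ} {g g' : Fin m → ℚ} {h h' : Fin n → ℚ}
    (hg : IsChain g) (hg' : IsChain g')
    (H : ∀ v, multB h v < multB g v ↔ multB h' v < multB g' v) :
    (unmatched g h).image g = (unmatched g' h').image g' := by
  ext v
  simp only [mem_image]
  by_cases hv : v = 0
  · subst hv
    constructor <;> rintro ⟨i, hi, h0⟩ <;> exact absurd h0 (mem_unmatched.1 hi).1
  · rw [← hg.multB_lt_iff h hv, ← hg'.multB_lt_iff h' hv, H]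

/-- The numbers of matched nonzero entries in two chains agree. -/
lemma card_unmatched {m n : ℕ} {g : Fin m → ℚ} {h : Fin n → ℚ}
    (hg : IsChain g) (hh : IsChain h) :
    m + (unmatched h g).card + multB h 0 = n + (unmatched g h).card + multB g 0 := by
  have split : ∀ {m n : ℕ} (g : Fin m → ℚ) (h : Fin n → ℚ),
      m = (unmatched g h).card + multB g 0
        + (univ.filter fun i => g i ≠ 0 ∧ ∃ j, h j = g i).card := by
    intro m n g h
    have h1 := Finset.card_filter_add_card_filter_not (s := (univ : Finset (Fin m)))
      (fun i => g i = 0)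
    have h2 := Finset.card_filter_add_card_filter_not
      (s := (univ : Finset (Fin m)).filter fun i => ¬ g i = 0) (fun i => ∃ j, h j = g i)
    rw [filter_filter, filter_filter] at h2
    have h3 : (unmatched g h) = univ.filter fun i => ¬ g i = 0 ∧ ¬ ∃ j, h j = g i := by
      ext i; simp [mem_unmatched]
    rw [← h3] at h2
    simp only [card_univ, Fintype.card_fin] at h1
    simp only [multB, ne_eq]
    omega
  have key : (univ.filter fun i => g i ≠ 0 ∧ ∃ j, h j = g i).card
      = (univ.filter fun j => h j ≠ 0 ∧ ∃ i, g i = h j).card := by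
    rw [← Finset.card_image_of_injOn (f := g)
        (hg.injOn.mono fun i hi => (Finset.mem_filter.1 hi).2.1),
      ← Finset.card_image_of_injOn (f := h)
        (hh.injOn.mono fun i hi => (Finset.mem_filter.1 hi).2.1)]
    congr 1
    ext v
    simp only [mem_image, mem_filter, mem_univ, true_and]
    constructor
    · rintro ⟨i, ⟨h0, j, hj⟩, rfl⟩
      exact ⟨j, ⟨hj ▸ h0, i, hj.symm⟩, hj⟩
    · rintro ⟨j, ⟨h0, i, hi⟩, rfl⟩
      exact ⟨i, ⟨hi ▸ h0, j, hi.symm⟩, hi⟩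
  have e1 := split g h
  have e2 := split h g
  omega

lemma eq_initial_of_lower {m : ℕ} (s : Finset (Fin m)) (hs : ∀ i j, i ≤ j → j ∈ s → i ∈ s) :
    s = initial m s.card := by
  ext i
  rw [mem_initial]
  constructor
  · intro hi
    have := Finset.card_le_card (show Finset.Iic i ⊆ s from
      fun j hj => hs j i (Finset.mem_Iic.1 hj) hi)
    rw [Fin.card_Iic] at this
    omega
  · intro hi
    by_contra hn
    have := Finset.card_le_card (show s ⊆ Finset.Iio i from fun j hj =>
      Finset.mem_Iio.2 (lt_of_not_ge fun hij => hn (hs i j hij hj)))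
    rw [Fin.card_Iio] at this
    omega

lemma card_initial {m p : ℕ} (hp : p ≤ m) : (initial m p).card = p := by
  rw [initial, Fin.card_filter_val_lt, min_eq_right hp]

/-- If every matched entry is smaller than every unmatched one, the unmatched entries come first. -/
lemma unmatched_eq_initial {m n : ℕ} {g : Fin m → ℚ} {h : Fin n → ℚ} (hg : IsChain g)
    (hst : ∀ i ∈ unmatched g h, ∀ l, (∃ j, h j = g l) → g l < g i) :
    unmatched g h = initial m (unmatched g h).card := by
  refine eq_initial_of_lower _ fun i j hij hj => ?_
  have hj' := mem_unmatched.1 hj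
  have hpos : 0 < g j := lt_of_le_of_ne (hg.nonneg j) hj'.1.symm
  have hle := hg.anti i j hij
  refine mem_unmatched.2 ⟨(hpos.trans_le hle).ne', fun l hl => ?_⟩
  linarith [hst j hj i ⟨l, hl⟩]

/-- The first entries of a chain have the largest sum among sets of the same size. -/
lemma IsChain.eq_initial_or_sum_lt {m : ℕ} {g : Fin m → ℚ} (hg : IsChain g)
    (s : Finset (Fin m)) (hs : ∀ i ∈ s, g i ≠ 0) :
    s = initial m s.card ∨ ∑ i ∈ s, g i < ∑ i ∈ initial m s.card, g i := by
  have hcard : (initial m s.card).card = s.card :=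
    card_initial (by simpa using Finset.card_le_univ s)
  by_cases hsub : s ⊆ initial m s.card
  · exact Or.inl (Finset.eq_of_subset_of_card_le hsub hcard.le)
  right
  set I := initial m s.card with hI
  obtain ⟨j, hjs, hjI⟩ := Finset.not_subset.1 hsub
  have hjp : s.card ≤ (j : ℕ) := by
    rw [hI, mem_initial] at hjI; omega
  let r : Fin m := ⟨s.card, by omega⟩
  have hr : 0 < g r :=
    lt_of_lt_of_le (lt_of_le_of_ne (hg.nonneg j) (hs j hjs).symm) (hg.anti r j hjp)
  have hout : ∀ i ∈ s \ I, g i ≤ g r := by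
    intro i hi
    have := (Finset.mem_sdiff.1 hi).2
    rw [hI, mem_initial] at this
    exact hg.anti r i (by rw [Fin.le_def]; simp only [r]; omega)
  have hin : ∀ i ∈ I \ s, g r < g i := by
    intro i hi
    have := (Finset.mem_sdiff.1 hi).1
    rw [hI, mem_initial] at this
    have hir : i < r := this
    refine lt_of_le_of_ne (hg.anti i r hir.le) fun he => ?_
    have := hg.eq_zero i r hir he.symm
    linarith
  have hc : (s \ I).card = (I \ s).card := by
    have h1 := Finset.card_sdiff_add_card_inter s I
    have h2 := Finset.card_sdiff_add_card_inter I s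
    rw [Finset.inter_comm] at h2
    omega
  have hne : (I \ s).Nonempty := by
    rw [← Finset.card_pos, ← hc, Finset.card_pos]
    exact ⟨j, Finset.mem_sdiff.2 ⟨hjs, hjI⟩⟩
  have e1 := Finset.sum_inter_add_sum_sdiff s I g
  have e2 := Finset.sum_inter_add_sum_sdiff I s g
  rw [Finset.inter_comm] at e2
  have l1 := Finset.sum_le_card_nsmul _ _ _ hout
  have l2 : ∑ _i ∈ I \ s, g r < ∑ i ∈ I \ s, g i := Finset.sum_lt_sum_of_nonempty hne hin
  rw [Finset.sum_const, ← hc] at l2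
  linarith

/-- The sum of the first `p` coordinates in `ℚ^m` and the first `q` coordinates in `ℚ^n`. -/
def prefixSum (m n p q : ℕ) : V m n →ₗ[ℚ] ℚ where
  toFun x := ∑ i ∈ initial m p, x.1 i + ∑ j ∈ initial n q, x.2 j
  map_add' x y := by simp [Finset.sum_add_distrib]; ring
  map_smul' c x := by simp [Finset.mul_sum, mul_add]

lemma sum_initial_indicator {m p : ℕ} (hp : p ≤ m) (t : ℕ) :
    (∑ i ∈ initial m p, if (i : ℕ) + 1 = t then (1 : ℚ) else 0)
      = if 1 ≤ t ∧ t ≤ p then 1 else 0 := by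
  split_ifs with h
  · rw [Finset.sum_eq_single (⟨t - 1, by omega⟩ : Fin m)]
    · simp only; rw [if_pos (by omega)]
    · intro i _ hi
      rw [if_neg fun h' => hi (Fin.ext (by simp only; omega))]
    · intro hn
      exact absurd (mem_initial.2 (by simp only; omega)) hn
  · refine Finset.sum_eq_zero fun i hi => if_neg fun h' => h ?_
    have := mem_initial.1 hi
    omega

lemma prefixSum_eps {m n p q : ℕ} (hp : p ≤ m) (t : ℕ) :
    prefixSum m n p q (eps m n t) = if 1 ≤ t ∧ t ≤ p then 1 else 0 := by
  simp [prefixSum, eps, sum_initial_indicator hp]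

lemma prefixSum_delta {m n p q : ℕ} (hq : q ≤ n) (t : ℕ) :
    prefixSum m n p q (delta m n t) = if 1 ≤ t ∧ t ≤ q then 1 else 0 := by
  simp [prefixSum, delta, sum_initial_indicator hq]

lemma prefixSum_uD {m n p q : ℕ} (hp : p < m) (hq : q < n)
    (hpq : p + n = m + q ∨ p + n + 1 = m + q) {t : ℕ} (ht : 1 ≤ t) :
    prefixSum m n p q (uD m n t) = if t ≤ p + q then 1 else 0 := by
  unfold uD
  split_ifs <;> simp only [prefixSum_eps hp.le, prefixSum_delta hq.le] <;> split_ifs <;>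
    first | rfl | omega

lemma prefixSum_rootD_nonneg {m n p q : ℕ} (hp : p < m) (hq : q < n)
    (hpq : p + n = m + q ∨ p + n + 1 = m + q) {t : ℕ} (ht : 1 ≤ t) :
    0 ≤ prefixSum m n p q (rootD m n t) := by
  unfold rootD
  split_ifs
  · rw [map_sub, prefixSum_uD hp hq hpq ht, prefixSum_uD hp hq hpq (by omega)]
    split_ifs <;> first | omega | norm_num
  · rw [map_sub, prefixSum_eps hp.le, prefixSum_delta hq.le, if_neg (by omega),
      if_neg (by omega), sub_self]
  · rw [map_add, prefixSum_eps hp.le, prefixSum_delta hq.le, if_neg (by omega),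
      if_neg (by omega), add_zero]

lemma prefixSum_mono {m n p q : ℕ} (hp : p < m) (hq : q < n)
    (hpq : p + n = m + q ∨ p + n + 1 = m + q) {A B : V m n} (hle : leD m n B A) :
    prefixSum m n p q B ≤ prefixSum m n p q A := by
  obtain ⟨c, hc⟩ := hle
  rw [← sub_nonneg, ← map_sub, hc, map_sum]
  refine Finset.sum_nonneg fun t ht => ?_
  rw [map_smul, smul_eq_mul]
  exact mul_nonneg (Nat.cast_nonneg _)
    (prefixSum_rootD_nonneg hp hq hpq (Finset.mem_Icc.1 ht).1)

lemma DDominant.achain_eq {m n : ℕ} {a : Fin m → ℚ} {b : Fin n → ℚ} (h : DDominant a b)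
    (i : Fin m) : achain a i = |a i| := by
  unfold achain
  split_ifs with hi
  · rfl
  · exact (abs_of_nonneg (h.1 i (by omega))).symm

lemma DDominant.isChain_abs {m n : ℕ} {a : Fin m → ℚ} {b : Fin n → ℚ} (h : DDominant a b) :
    IsChain fun i => |a i| where
  nonneg i := abs_nonneg _
  anti i j hij := by simpa only [h.achain_eq] using h.2.1 i j hij
  eq_zero i j hij := by simpa only [h.achain_eq] using h.2.2.1 i j hij

lemma DDominant.isChain_right {m n : ℕ} {a : Fin m → ℚ} {b : Fin n → ℚ} (h : DDominant a b) :
    IsChain b :=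
  ⟨h.2.2.2.1, h.2.2.2.2.1, h.2.2.2.2.2.1⟩

lemma DDominant.sum_initial {m n p : ℕ} {a : Fin m → ℚ} {b : Fin n → ℚ} (h : DDominant a b)
    (hp : p < m) : ∑ i ∈ initial m p, a i = ∑ i ∈ initial m p, |a i| :=
  Finset.sum_congr rfl fun i hi =>
    (abs_of_nonneg (h.1 i (by have := mem_initial.1 hi; omega))).symm

/-- An entry outside an initial set of unmatched entries is below every unmatched entry. -/
lemma IsChain.lt_of_unmatched_initial {m n p : ℕ} {g : Fin m → ℚ} {h : Fin n → ℚ}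
    (hg : IsChain g) (hI : unmatched g h = initial m p) {i l : Fin m}
    (hi : i ∉ unmatched g h) (hl : l ∈ unmatched g h) : g i < g l := by
  have h0 := (mem_unmatched.1 hl).1
  rw [hI, mem_initial] at hi hl
  have hli : l < i := by rw [Fin.lt_def]; omega
  exact lt_of_le_of_ne (hg.anti l i hli.le) fun he => h0 (hg.eq_zero l i hli he.symm)

/-- **Corollary 5.4** for `osp(2m|2n)`: a dominant datum `B ≤ A` with the same
core as a stable dominant datum `A` is itself stable. -/
theorem DStable_of_le_of_equalCore (m n : ℕ) (hm : 1 ≤ m)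
    (a a' : Fin m → ℚ) (b b' : Fin n → ℚ)
    (hAdatum : IsDDatum a b) (hBdatum : IsDDatum a' b')
    (hAdom : DDominant a b) (hBdom : DDominant a' b')
    (hAstable : DStable a b)
    (hcore : EqualCore a b a' b')
    (hle : leD m n (a', b') (a, b)) :
    DStable a' b' := by
  have hA := hAdom.isChain_abs
  have hA' := hBdom.isChain_abs
  have hb := hAdom.isChain_right
  have hb' := hBdom.isChain_right
  set g : Fin m → ℚ := fun i => |a i|
  set g' : Fin m → ℚ := fun i => |a' i|
  intro v w hv hw hw0
  obtain ⟨hv1, hv2⟩ := le_min_iff.1 hv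
  obtain ⟨i₀, hi₀⟩ := one_le_multB.1 (show 1 ≤ multB g' v from hv1)
  obtain ⟨j₀, hj₀⟩ := one_le_multB.1 hv2
  have hi₀P : i₀ ∉ unmatched g' b' := fun h =>
    (mem_unmatched.1 h).2 j₀ (hj₀.trans hi₀.symm)
  have hj₀Q : j₀ ∉ unmatched b' g' := fun h =>
    (mem_unmatched.1 h).2 i₀ (hi₀.trans hj₀.symm)
  have imP := image_unmatched_eq hA hA' (h := b) (h' := b') hcore.1
  have imQ := image_unmatched_eq hb hb' (h := g) (h' := g') hcore.2
  have transfer : ∀ {k : ℕ} {x y : Fin k → ℚ} {s t : Finset (Fin k)}, Set.InjOn x s →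
      Set.InjOn y t → s.image x = t.image y →
      s.card = t.card ∧ ∑ i ∈ s, x i = ∑ i ∈ t, y i := by
    intro k x y s t hx hy him
    constructor
    · rw [← Finset.card_image_of_injOn hx, him, Finset.card_image_of_injOn hy]
    · have ex : ∑ z ∈ s.image x, z = ∑ i ∈ s, x i := Finset.sum_image hx
      have ey : ∑ z ∈ t.image y, z = ∑ i ∈ t, y i := Finset.sum_image hy
      rw [← ex, him, ey]
  obtain ⟨cP, sP⟩ := transfer (hA.injOn_unmatched b) (hA'.injOn_unmatched b') imP
  obtain ⟨cQ, sQ⟩ := transfer (hb.injOn_unmatched g) (hb'.injOn_unmatched g') imQ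
  have hp : (unmatched g' b').card < m := by
    simpa using Finset.card_lt_univ_of_notMem hi₀P
  have hq : (unmatched b' g').card < n := by
    simpa using Finset.card_lt_univ_of_notMem hj₀Q
  have hcard := card_unmatched hA' hb'
  have hz1 : multB b' 0 ≤ multB g' 0 := hBdom.2.2.2.2.2.2.1
  have hz2 : multB g' 0 ≤ multB b' 0 + 1 := hBdom.2.2.2.2.2.2.2
  have initP : unmatched g b = initial m (unmatched g b).card := by
    refine unmatched_eq_initial hA fun i hi l hl => ?_
    have h0 := (mem_unmatched.1 hi).1
    exact hAstable _ _ (le_min (one_le_multB.2 ⟨l, rfl⟩) (one_le_multB.2 hl))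
      (Or.inl ((hA.multB_lt_iff b h0).2 ⟨i, hi, rfl⟩)) h0
  have initQ : unmatched b g = initial n (unmatched b g).card := by
    refine unmatched_eq_initial hb fun i hi l hl => ?_
    have h0 := (mem_unmatched.1 hi).1
    exact hAstable _ _ (le_min (one_le_multB.2 hl) (one_le_multB.2 ⟨l, rfl⟩))
      (Or.inr ((hb.multB_lt_iff g h0).2 ⟨i, hi, rfl⟩)) h0
  have hmono := prefixSum_mono hp hq (by omega) hle
  have hsum : ∑ i ∈ initial m (unmatched g' b').card, g' i
      + ∑ j ∈ initial n (unmatched b' g').card, b' j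
      ≤ ∑ i ∈ initial m (unmatched g' b').card, g i
      + ∑ j ∈ initial n (unmatched b' g').card, b j := by
    rw [← hAdom.sum_initial hp, ← hBdom.sum_initial hp]
    exact hmono
  rw [cP] at initP
  rw [cQ] at initQ
  rw [← initP, ← initQ, sP, sQ, initP, initQ] at hsum
  have dP := hA'.eq_initial_or_sum_lt _ fun i hi => (mem_unmatched (h := b').1 hi).1
  have dQ := hb'.eq_initial_or_sum_lt _ fun i hi => (mem_unmatched (h := g').1 hi).1
  have lP : ∑ i ∈ unmatched g' b', g' i ≤ ∑ i ∈ initial m (unmatched g' b').card, g' i :=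
    dP.elim (fun h => by rw [← h]) le_of_lt
  have lQ : ∑ i ∈ unmatched b' g', b' i ≤ ∑ i ∈ initial n (unmatched b' g').card, b' i :=
    dQ.elim (fun h => by rw [← h]) le_of_lt
  rcases hw with hw | hw
  · obtain ⟨l, hl, rfl⟩ := (hA'.multB_lt_iff b' hw0).1 hw
    rw [← hi₀]
    refine hA'.lt_of_unmatched_initial (dP.resolve_right fun h => ?_) hi₀P hl
    linarith
  · obtain ⟨l, hl, rfl⟩ := (hb'.multB_lt_iff g' hw0).1 hw
    rw [← hj₀]
    refine hb'.lt_of_unmatched_initial (dQ.resolve_right fun h => ?_) hj₀Q hl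
    linarith

end GorelikHeidersdorfD
end
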